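/- (Gagliardo–Nirenberg-type inequality.) For any $p > 2$ and $s > 0$ there exists $C > 0$ such that for every function $f : \mathbb{T} \to \mathbb{R}$ smooth enough, $\||D|^s f\|_{L^p} \leq C\big(\|f\|_{L^\infty} + \||D|^{sp/2} f\|_{L^2}^{2/p} \|f\|_{L^\infty}^{1 - 2/p}\big)$. -/

import Mathlib

open Real Complex MeasureTheory

noncomputable section

instance : Fact (0 < 2 * π) := ⟨by positivity⟩

/-- The one-dimensional torus. -/
abbrev Torus := AddCircle (2 * π)

/-- The Fourier multiplier `|D|^ρ`. -/
def fracD (ρ : ℝ) (w : Torus → ℂ) : Torus → ℂ :=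
  fun x => ∑' k : ℤ, ((|(k : ℝ)| ^ ρ : ℝ) : ℂ) * fourierCoeff w k * fourier k x

/-- The forward difference of `n ↦ n ^ s`. -/
def powDiff (s : ℝ) (n : ℕ) : ℝ := ((n : ℝ) + 1) ^ s - (n : ℝ) ^ s

lemma powDiff_nonneg {s : ℝ} (hs : 0 < s) (n : ℕ) : 0 ≤ powDiff s n :=
  sub_nonneg.2 (rpow_le_rpow (by positivity) (by linarith) hs.le)

lemma powDiff_succ_sub (s : ℝ) (n : ℕ) :
    powDiff s (n + 1) - powDiff s n
      = ((n : ℝ) + 2) ^ s + (n : ℝ) ^ s - 2 * ((n : ℝ) + 1) ^ s := by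
  have : ((n : ℝ) + 1 + 1) = n + 2 := by ring
  simp only [powDiff, Nat.cast_add, Nat.cast_one, this]
  ring

lemma powDiff_le_succ {s : ℝ} (hs : 1 ≤ s) (n : ℕ) : powDiff s n ≤ powDiff s (n + 1) := by
  have h := (convexOn_rpow hs).2 (Set.mem_Ici.2 (by positivity : 0 ≤ (n : ℝ)))
    (Set.mem_Ici.2 (by positivity : 0 ≤ (n : ℝ) + 2))
    (by norm_num : (0 : ℝ) ≤ 1 / 2) (by norm_num : (0 : ℝ) ≤ 1 / 2) (by norm_num)
  have e : (1 / 2 : ℝ) • (n : ℝ) + (1 / 2 : ℝ) • ((n : ℝ) + 2) = n + 1 := by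
    simp only [smul_eq_mul]; ring
  rw [e] at h
  simp only [smul_eq_mul] at h
  linarith [powDiff_succ_sub s n]

lemma powDiff_succ_le {s : ℝ} (hs : 0 ≤ s) (hs1 : s ≤ 1) (n : ℕ) :
    powDiff s (n + 1) ≤ powDiff s n := by
  have h := (concaveOn_rpow hs hs1).2 (Set.mem_Ici.2 (by positivity : 0 ≤ (n : ℝ)))
    (Set.mem_Ici.2 (by positivity : 0 ≤ (n : ℝ) + 2))
    (by norm_num : (0 : ℝ) ≤ 1 / 2) (by norm_num : (0 : ℝ) ≤ 1 / 2) (by norm_num)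
  have e : (1 / 2 : ℝ) • (n : ℝ) + (1 / 2 : ℝ) • ((n : ℝ) + 2) = n + 1 := by
    simp only [smul_eq_mul]; ring
  rw [e] at h
  simp only [smul_eq_mul] at h
  linarith [powDiff_succ_sub s n]

lemma one_sub_mul_le_rpow {s t : ℝ} (hs : 0 < s) (ht : 0 ≤ t) (ht1 : t ≤ 1) :
    1 - max 1 s * t ≤ (1 - t) ^ s := by
  rcases le_total 1 s with h | h
  · rw [max_eq_right h]
    have := one_add_mul_self_le_rpow_one_add (s := -t) (by linarith) h
    rw [← sub_eq_add_neg] at this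
    linarith
  · rw [max_eq_left h, one_mul]
    calc 1 - t = (1 - t) ^ (1 : ℝ) := (rpow_one _).symm
      _ ≤ (1 - t) ^ s := rpow_le_rpow_of_exponent_ge' (by linarith) (by linarith) hs.le h

lemma nat_mul_powDiff_le {s : ℝ} (hs : 0 < s) {N : ℕ} (hN : 1 ≤ N) :
    N * powDiff s N ≤ max 1 s * 2 ^ s * (N : ℝ) ^ s := by
  have hN' : (1 : ℝ) ≤ N := by exact_mod_cast hN
  have hpos : (0 : ℝ) < (N : ℝ) + 1 := by positivity
  have h := one_sub_mul_le_rpow hs (t := 1 / ((N : ℝ) + 1)) (by positivity)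
    (by rw [div_le_one hpos]; linarith)
  have e : 1 - 1 / ((N : ℝ) + 1) = N / (N + 1) := by field_simp; ring
  rw [e, div_rpow (by positivity) hpos.le, le_div_iff₀ (by positivity)] at h
  have h2 : powDiff s N ≤ max 1 s * (((N : ℝ) + 1) ^ s / (N + 1)) := by
    have : (1 - max 1 s * (1 / ((N : ℝ) + 1))) * ((N : ℝ) + 1) ^ s
        = ((N : ℝ) + 1) ^ s - max 1 s * (((N : ℝ) + 1) ^ s / (N + 1)) := by ring
    rw [this] at h
    unfold powDiff
    linarith
  have hm : (0 : ℝ) < max 1 s := lt_max_of_lt_left one_pos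
  calc N * powDiff s N ≤ (N + 1) * (max 1 s * (((N : ℝ) + 1) ^ s / (N + 1))) :=
        mul_le_mul (by linarith) h2 (powDiff_nonneg hs N) hpos.le
    _ = max 1 s * ((N : ℝ) + 1) ^ s := by field_simp
    _ ≤ max 1 s * (2 * (N : ℝ)) ^ s := by gcongr; linarith
    _ = max 1 s * 2 ^ s * (N : ℝ) ^ s := by
        rw [mul_rpow (by norm_num) (by positivity), mul_assoc]

/-- A multiplier that agrees with `k ^ s` for `k ≤ N`, written as a combination of the
(unnormalised) Fejér multipliers `k ↦ (n - k)₊`. -/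
def lowSymbol (s : ℝ) (N k : ℕ) : ℝ :=
  (N : ℝ) ^ s / N * (((2 * N - k : ℕ) : ℝ) - ((N - k : ℕ) : ℝ)) - powDiff s N * ((N - k : ℕ) : ℝ)
    + ∑ m ∈ Finset.range N, (powDiff s (m + 1) - powDiff s m) * ((m + 1 - k : ℕ) : ℝ)

lemma sum_powDiff_eq (s : ℝ) {N k : ℕ} (h : k ≤ N) :
    ∑ m ∈ Finset.range N, (powDiff s (m + 1) - powDiff s m) * ((m + 1 - k : ℕ) : ℝ)
      = (k : ℝ) ^ s - (N : ℝ) ^ s + powDiff s N * ((N - k : ℕ) : ℝ) := by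
  induction N, h using Nat.le_induction with
  | base =>
    simp only [sub_self, Nat.sub_self, Nat.cast_zero, mul_zero, add_zero]
    refine Finset.sum_eq_zero fun m hm => ?_
    rw [Nat.sub_eq_zero_of_le (Finset.mem_range.1 hm)]
    simp
  | succ n hn ih =>
    rw [Finset.sum_range_succ, ih, Nat.cast_sub hn, Nat.cast_sub (hn.trans n.le_succ)]
    have : powDiff s n = ((n : ℝ) + 1) ^ s - (n : ℝ) ^ s := rfl
    push_cast
    linear_combination (-1 : ℝ) * this

lemma lowSymbol_of_le (s : ℝ) {N k : ℕ} (hN : 1 ≤ N) (h : k ≤ N) :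
    lowSymbol s N k = (k : ℝ) ^ s := by
  have hN' : (N : ℝ) ≠ 0 := by positivity
  rw [lowSymbol, sum_powDiff_eq s h, Nat.cast_sub h, Nat.cast_sub (h.trans (by omega))]
  push_cast
  field_simp
  ring

lemma lowSymbol_of_lt (s : ℝ) {N k : ℕ} (h : N < k) :
    lowSymbol s N k = (N : ℝ) ^ s / N * ((2 * N - k : ℕ) : ℝ) := by
  rw [lowSymbol, Finset.sum_eq_zero, Nat.sub_eq_zero_of_le h.le]
  · simp
  · intro m hm
    rw [Nat.sub_eq_zero_of_le (by have := Finset.mem_range.1 hm; omega)]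
    simp

lemma abs_rpow_sub_lowSymbol_le {s : ℝ} (hs : 0 < s) {N : ℕ} (hN : 1 ≤ N) (k : ℕ) :
    |(k : ℝ) ^ s - lowSymbol s N k| ≤ if N < k then (k : ℝ) ^ s else 0 := by
  split_ifs with h
  · have hN' : (0 : ℝ) < N := by exact_mod_cast hN
    have h1 : ((2 * N - k : ℕ) : ℝ) ≤ N := by exact_mod_cast (by omega : 2 * N - k ≤ N)
    have h2 : (N : ℝ) ^ s ≤ (k : ℝ) ^ s :=
      rpow_le_rpow hN'.le (by exact_mod_cast h.le) hs.le
    have h3 : (N : ℝ) ^ s / N * ((2 * N - k : ℕ) : ℝ) ≤ (N : ℝ) ^ s := by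
      calc _ ≤ (N : ℝ) ^ s / N * N := by gcongr
        _ = _ := by field_simp
    have h4 : 0 ≤ (N : ℝ) ^ s / N * ((2 * N - k : ℕ) : ℝ) := by positivity
    rw [lowSymbol_of_lt s h, abs_of_nonneg (by linarith)]
    linarith
  · rw [lowSymbol_of_le s hN (not_lt.1 h), sub_self, abs_zero]

lemma sum_abs_powDiff_le {s : ℝ} (hs : 0 < s) (N : ℕ) :
    ∑ m ∈ Finset.range N, |powDiff s (m + 1) - powDiff s m| * ((m + 1 : ℕ) : ℝ)
      ≤ (N : ℝ) ^ s + N * powDiff s N := by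
  have h0 := sum_powDiff_eq s (Nat.zero_le N)
  simp only [Nat.sub_zero, Nat.cast_zero, zero_rpow hs.ne'] at h0
  have h1 : 0 ≤ (N : ℝ) ^ s := by positivity
  have h2 : 0 ≤ N * powDiff s N := mul_nonneg (by positivity) (powDiff_nonneg hs N)
  rcases le_total 1 s with h | h
  · simp only [fun m => abs_of_nonneg (sub_nonneg.2 (powDiff_le_succ h m))]
    linarith
  · simp only [fun m => abs_of_nonpos (sub_nonpos.2 (powDiff_succ_le hs.le h m)), neg_mul,
      Finset.sum_neg_distrib]
    linarith

lemma hasSum_ite_natAbs_le (φ : ℤ → ℂ) (n : ℕ) :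
    HasSum (fun k : ℤ => if k.natAbs ≤ n then φ k else 0)
      (φ 0 + ∑ j ∈ Finset.range n, (φ (j + 1) + φ (-(j + 1)))) := by
  induction n with
  | zero =>
    convert! hasSum_ite_eq (0 : ℤ) (φ 0) using 2 with k
    · by_cases h : k = 0 <;> simp [h]
    · simp
  | succ n ih =>
    have h1 := hasSum_ite_eq ((n : ℤ) + 1) (φ (n + 1))
    have h2 := hasSum_ite_eq (-((n : ℤ) + 1)) (φ (-(n + 1)))
    convert! ih.add (h1.add h2) using 1
    · funext k
      rcases eq_or_ne k (n + 1) with rfl | hk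
      · rw [if_pos (by omega), if_neg (by omega), if_pos rfl, if_neg (by omega)]
        simp
      rcases eq_or_ne k (-(n + 1)) with rfl | hk'
      · rw [if_pos (by omega), if_neg (by omega), if_neg (by omega), if_pos rfl]
        simp
      rw [if_neg hk, if_neg hk', add_zero, add_zero]
      exact if_congr (by omega) rfl rfl
    · rw [Finset.sum_range_succ]
      ring

lemma hasSum_fejer (φ : ℤ → ℂ) (n : ℕ) :
    HasSum (fun k : ℤ => ((n - k.natAbs : ℕ) : ℂ) * φ k)
      (∑ i ∈ Finset.range n, ∑ j ∈ Finset.range n, φ (i - j)) := by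
  induction n with
  | zero => simp
  | succ n ih =>
    convert! ih.add (hasSum_ite_natAbs_le φ n) using 1
    · funext k
      split_ifs with h
      · rw [Nat.succ_sub h]
        push_cast
        ring
      · rw [Nat.sub_eq_zero_of_le (by omega), Nat.sub_eq_zero_of_le (by omega)]
        simp
    · have h1 : ∑ j ∈ Finset.range n, φ (n - j) = ∑ j ∈ Finset.range n, φ (j + 1) := by
        rw [← Finset.sum_range_reflect]
        refine Finset.sum_congr rfl fun j hj => ?_
        have := Finset.mem_range.1 hj
        congr 1
        omega
      have h2 : ∑ j ∈ Finset.range n, φ (j - n) = ∑ j ∈ Finset.range n, φ (-(j + 1)) := by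
        rw [← Finset.sum_range_reflect]
        refine Finset.sum_congr rfl fun j hj => ?_
        have := Finset.mem_range.1 hj
        congr 1
        omega
      simp only [Finset.sum_range_succ, Finset.sum_add_distrib, h1, h2, sub_self]
      ring

lemma integral_fourier (k : ℤ) :
    ∫ t : Torus, fourier k t ∂AddCircle.haarAddCircle = if k = 0 then 1 else 0 := by
  have h := congrFun (fourierCoeff_fourier (T := 2 * π) 0) (-k)
  simpa only [fourierCoeff, neg_neg, Pi.single_apply, neg_eq_zero, smul_eq_mul, fourier_zero,
    mul_one] using h

lemma sum_fourier_sub_eq (n : ℕ) (y : Torus) :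
    ∑ i ∈ Finset.range n, ∑ j ∈ Finset.range n, fourier ((i : ℤ) - j) y
      = ((‖∑ i ∈ Finset.range n, fourier (i : ℤ) y‖ ^ 2 : ℝ) : ℂ) := by
  push_cast
  rw [← Complex.mul_conj', map_sum, Finset.sum_mul_sum]
  refine Finset.sum_congr rfl fun i _ => Finset.sum_congr rfl fun j _ => ?_
  rw [sub_eq_add_neg, fourier_add, fourier_neg]

lemma integral_norm_sq_dirichlet (n : ℕ) :
    ∫ t : Torus, ‖∑ i ∈ Finset.range n, fourier (i : ℤ) t‖ ^ 2 ∂AddCircle.haarAddCircle = n := by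
  have h : ((∫ t : Torus, ‖∑ i ∈ Finset.range n, fourier (i : ℤ) t‖ ^ 2
      ∂AddCircle.haarAddCircle : ℝ) : ℂ) = n := by
    rw [← integral_complex_ofReal]
    simp_rw [← sum_fourier_sub_eq]
    have hint : ∀ k : ℤ, Integrable (fun t : Torus => (fourier k t : ℂ))
        AddCircle.haarAddCircle := fun k =>
      (map_continuous (fourier k)).integrable_of_hasCompactSupport
        (HasCompactSupport.of_compactSpace _)
    rw [integral_finsetSum _ fun i _ => integrable_finsetSum _ fun j _ => hint _]
    simp_rw [integral_finsetSum _ fun j _ => hint _, integral_fourier, sub_eq_zero, Nat.cast_inj,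
      Finset.sum_ite_eq]
    rw [Finset.sum_congr rfl fun i hi => if_pos hi]
    simp
  exact_mod_cast h

lemma norm_fejer_sum_le {w : Torus → ℂ} (hw : Continuous w) {M : ℝ} (hM : ∀ x, ‖w x‖ ≤ M)
    (n : ℕ) (x : Torus) :
    ‖∑ i ∈ Finset.range n, ∑ j ∈ Finset.range n,
      fourierCoeff w ((i : ℤ) - j) * fourier ((i : ℤ) - j) x‖ ≤ n * M := by
  have hcint : ∀ g : Torus → ℂ, Continuous g → Integrable g AddCircle.haarAddCircle :=
    fun g hg => hg.integrable_of_hasCompactSupport (HasCompactSupport.of_compactSpace _)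
  have hc : ∀ k : ℤ, Continuous fun t : Torus => w t * fourier k (x - t) := fun k =>
    hw.mul ((map_continuous (fourier k)).comp (continuous_const.sub continuous_id))
  have h1 : ∀ k : ℤ, fourierCoeff w k * fourier k x
      = ∫ t : Torus, w t * fourier k (x - t) ∂AddCircle.haarAddCircle := by
    intro k
    rw [fourierCoeff, ← integral_mul_const]
    refine integral_congr_ae (Filter.Eventually.of_forall fun t => ?_)
    have : (fourier k (x - t) : ℂ) = fourier k x * fourier (-k) t := by
      simp only [fourier_apply, ← Circle.coe_mul, ← AddCircle.toCircle_add, smul_add, smul_neg,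
        neg_smul, sub_eq_add_neg]
    simp only [smul_eq_mul, this]
    ring
  simp_rw [h1]
  simp_rw [← integral_finsetSum _ fun j _ => hcint _ (hc _)]
  rw [← integral_finsetSum _ fun i _ => integrable_finsetSum _ fun j _ => hcint _ (hc _)]
  simp_rw [← Finset.mul_sum, sum_fourier_sub_eq]
  have hP : Continuous fun t : Torus => ‖∑ i ∈ Finset.range n, (fourier (i : ℤ) t : ℂ)‖ ^ 2 :=
    (continuous_norm.comp (continuous_finsetSum _ fun i _ => map_continuous (fourier _))).pow 2
  calc _ ≤ ∫ t : Torus, M * ‖∑ i ∈ Finset.range n, (fourier (i : ℤ) (x - t) : ℂ)‖ ^ 2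
          ∂AddCircle.haarAddCircle := by
        refine norm_integral_le_of_norm_le ?_ (Filter.Eventually.of_forall fun t => ?_)
        · exact (continuous_const.mul
            (hP.comp (continuous_const.sub continuous_id))).integrable_of_hasCompactSupport
              (HasCompactSupport.of_compactSpace _)
        · rw [norm_mul, Complex.norm_real, norm_of_nonneg (by positivity)]
          gcongr
          exact hM t
    _ = n * M := by
        rw [integral_const_mul, integral_sub_left_eq_self
          (fun t : Torus => ‖∑ i ∈ Finset.range n, (fourier (i : ℤ) t : ℂ)‖ ^ 2),
          integral_norm_sq_dirichlet, mul_comm]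

/-- The Fourier multiplier with symbol `h`. -/
def multiplier (h : ℤ → ℝ) (w : Torus → ℂ) (x : Torus) : ℂ :=
  ∑' k : ℤ, (h k : ℂ) * fourierCoeff w k * fourier k x

lemma norm_multiplier_fejer_le {w : Torus → ℂ} (hw : Continuous w) {M : ℝ} (hM : ∀ x, ‖w x‖ ≤ M)
    (n : ℕ) (x : Torus) : ‖multiplier (fun k => ((n - k.natAbs : ℕ) : ℝ)) w x‖ ≤ n * M := by
  have h := (hasSum_fejer (fun k => fourierCoeff w k * fourier k x) n).tsum_eq
  simp only [multiplier, Complex.ofReal_natCast, mul_assoc, h]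
  exact norm_fejer_sum_le hw hM n x

lemma hasSum_multiplier_fejer (w : Torus → ℂ) (n : ℕ) (x : Torus) :
    HasSum (fun k : ℤ => (((n - k.natAbs : ℕ) : ℝ) : ℂ) * fourierCoeff w k * fourier k x)
      (multiplier (fun k => ((n - k.natAbs : ℕ) : ℝ)) w x) := by
  have h := hasSum_fejer (fun k => fourierCoeff w k * fourier k x) n
  simp only [multiplier, Complex.ofReal_natCast, mul_assoc]
  exact h.summable.hasSum

lemma hasSum_multiplier_lowSymbol (w : Torus → ℂ) (s : ℝ) (N : ℕ) (x : Torus) :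
    HasSum (fun k : ℤ => (lowSymbol s N k.natAbs : ℂ) * fourierCoeff w k * fourier k x)
      ((((N : ℝ) ^ s / N : ℝ) : ℂ) * (multiplier (fun k => ((2 * N - k.natAbs : ℕ) : ℝ)) w x
          - multiplier (fun k => ((N - k.natAbs : ℕ) : ℝ)) w x)
        - (powDiff s N : ℂ) * multiplier (fun k => ((N - k.natAbs : ℕ) : ℝ)) w x
        + ∑ m ∈ Finset.range N, ((powDiff s (m + 1) - powDiff s m : ℝ) : ℂ)
          * multiplier (fun k => ((m + 1 - k.natAbs : ℕ) : ℝ)) w x) := by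
  have hF := fun n => hasSum_multiplier_fejer w n x
  have h := ((((hF (2 * N)).sub (hF N)).mul_left (((N : ℝ) ^ s / N : ℝ) : ℂ)).sub
    ((hF N).mul_left (powDiff s N : ℂ))).add
    (hasSum_sum fun m (_ : m ∈ Finset.range N) =>
      (hF (m + 1)).mul_left ((powDiff s (m + 1) - powDiff s m : ℝ) : ℂ))
  convert! h using 1
  funext k
  simp only [lowSymbol, Complex.ofReal_add, Complex.ofReal_sub, Complex.ofReal_mul,
    Complex.ofReal_sum, add_mul, sub_mul, mul_sub, Finset.sum_mul, mul_assoc]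

/-- The constant in the `L^∞` bound for the low-frequency multiplier. -/
def lowConst (s : ℝ) : ℝ := 4 + 2 * (max 1 s * 2 ^ s)

lemma lowConst_pos (s : ℝ) : 0 < lowConst s := by
  have : (0 : ℝ) < max 1 s := lt_max_of_lt_left one_pos
  unfold lowConst
  positivity

lemma norm_multiplier_lowSymbol_le {w : Torus → ℂ} (hw : Continuous w) {M : ℝ}
    (hM : ∀ x, ‖w x‖ ≤ M) {s : ℝ} (hs : 0 < s) {N : ℕ} (hN : 1 ≤ N) (x : Torus) :
    ‖multiplier (fun k => lowSymbol s N k.natAbs) w x‖ ≤ lowConst s * (N : ℝ) ^ s * M := by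
  have hF := fun n => norm_multiplier_fejer_le hw hM n x
  have hM0 : 0 ≤ M := (norm_nonneg _).trans (hM x)
  have hN' : (0 : ℝ) < N := by exact_mod_cast hN
  have hd := powDiff_nonneg hs N
  rw [multiplier, (hasSum_multiplier_lowSymbol w s N x).tsum_eq]
  have h1 : ‖(((N : ℝ) ^ s / N : ℝ) : ℂ) * (multiplier (fun k => ((2 * N - k.natAbs : ℕ) : ℝ)) w x
      - multiplier (fun k => ((N - k.natAbs : ℕ) : ℝ)) w x)‖ ≤ 3 * (N : ℝ) ^ s * M := by
    rw [norm_mul, Complex.norm_real, norm_of_nonneg (by positivity)]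
    calc _ ≤ (N : ℝ) ^ s / N * (((2 * N : ℕ) : ℝ) * M + N * M) := by
          gcongr
          exact (norm_sub_le _ _).trans (add_le_add (hF _) (hF _))
      _ = _ := by push_cast; field_simp; ring
  have h2 : ‖(powDiff s N : ℂ) * multiplier (fun k => ((N - k.natAbs : ℕ) : ℝ)) w x‖
      ≤ N * powDiff s N * M := by
    rw [norm_mul, Complex.norm_real, norm_of_nonneg hd]
    calc _ ≤ powDiff s N * (N * M) := by gcongr; exact hF N
      _ = _ := by ring
  have h3 : ‖∑ m ∈ Finset.range N, ((powDiff s (m + 1) - powDiff s m : ℝ) : ℂ)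
      * multiplier (fun k => ((m + 1 - k.natAbs : ℕ) : ℝ)) w x‖
      ≤ ((N : ℝ) ^ s + N * powDiff s N) * M := by
    refine (norm_sum_le _ _).trans ?_
    refine le_trans ?_ (mul_le_mul_of_nonneg_right (sum_abs_powDiff_le hs N) hM0)
    rw [Finset.sum_mul]
    refine Finset.sum_le_sum fun m _ => ?_
    rw [norm_mul, Complex.norm_real, Real.norm_eq_abs, mul_assoc]
    gcongr
    exact hF (m + 1)
  have h4 := mul_le_mul_of_nonneg_right (nat_mul_powDiff_le hs hN) hM0
  calc _ ≤ 3 * (N : ℝ) ^ s * M + N * powDiff s N * M + ((N : ℝ) ^ s + N * powDiff s N) * M :=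
        (norm_add_le _ _).trans (add_le_add ((norm_sub_le _ _).trans (add_le_add h1 h2)) h3)
    _ ≤ _ := by unfold lowConst; linarith

lemma eq_liftIoc (w : Torus → ℂ) :
    w = AddCircle.liftIoc (2 * π) 0 (fun t : ℝ => w t) := by
  funext x
  exact congrArg w ((AddCircle.equivIoc (2 * π) 0).symm_apply_apply x).symm

lemma abs_pow_mul_fourierCoeffOn_le (m : ℕ) {F : ℝ → ℂ} (hF : ContDiff ℝ (⊤ : ℕ∞) F)
    (hper : Function.Periodic F (2 * π)) :
    ∃ C, ∀ k : ℤ, |(k : ℝ)| ^ m *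
      ‖fourierCoeffOn (lt_add_of_pos_right (0 : ℝ) two_pi_pos) F k‖ ≤ C := by
  induction m generalizing F with
  | zero =>
    obtain ⟨C, hC⟩ := (isCompact_Icc (a := (0 : ℝ)) (b := 0 + 2 * π)).exists_bound_of_continuousOn
      hF.continuous.continuousOn
    refine ⟨|1 / (0 + 2 * π - 0)| * (C * |0 + 2 * π - 0|), fun k => ?_⟩
    rw [pow_zero, one_mul, fourierCoeffOn_eq_integral, norm_smul, Real.norm_eq_abs]
    gcongr
    refine intervalIntegral.norm_integral_le_of_norm_le_const fun t ht => ?_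
    rw [Set.uIoc_of_le (by positivity)] at ht
    rw [smul_eq_mul, norm_mul, fourier_apply, Circle.norm_coe, one_mul]
    exact hC t (Set.Ioc_subset_Icc_self ht)
  | succ m ih =>
    have hF' : ContDiff ℝ (⊤ : ℕ∞) (deriv F) := (contDiff_infty_iff_deriv.1 hF).2
    have hper' : Function.Periodic (deriv F) (2 * π) := fun t => by
      rw [← deriv_comp_add_const, show (fun x => F (x + 2 * π)) = F from funext hper]
    obtain ⟨C, hC⟩ := ih hF' hper'
    refine ⟨C, fun k => ?_⟩
    rcases eq_or_ne k 0 with rfl | hk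
    · simpa using (mul_nonneg (by positivity) (norm_nonneg _)).trans (hC 0)
    refine le_trans (le_of_eq ?_) (hC k)
    have hk' : |(k : ℝ)| ≠ 0 := by simpa using hk
    rw [fourierCoeffOn_of_hasDerivAt _ hk
      (fun t _ => (hF.differentiable (by simp) t).hasDerivAt)
      (hF'.continuous.intervalIntegrable _ _), hper 0]
    simp only [sub_self, mul_zero, zero_sub, norm_mul, norm_div, norm_neg, norm_one, zero_add,
      Complex.norm_real, Complex.norm_I, Complex.norm_intCast, Complex.norm_ofNat, sub_zero,
      Complex.ofReal_mul, Complex.ofReal_ofNat, Complex.ofReal_zero, norm_of_nonneg pi_pos.le,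
      mul_one]
    have := pi_pos
    field_simp
    ring

lemma summable_rpow_mul_fourierCoeff {w : Torus → ℂ}
    (hw : ContDiff ℝ (⊤ : ℕ∞) (fun t : ℝ => w t)) {ρ : ℝ} (hρ : 0 < ρ) :
    Summable fun k : ℤ => |(k : ℝ)| ^ ρ * ‖fourierCoeff w k‖ := by
  have hper : Function.Periodic (fun t : ℝ => w t) (2 * π) := fun t => by
    simp only [AddCircle.coe_add_period]
  obtain ⟨C, hC⟩ := abs_pow_mul_fourierCoeffOn_le (⌈ρ⌉₊ + 2) hw hper
  rw [eq_liftIoc w]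
  simp_rw [fourierCoeff_liftIoc_eq]
  refine Summable.of_nonneg_of_le (fun k => by positivity) (fun k => ?_)
    ((Real.summable_abs_int_rpow (b := 2) (by norm_num)).mul_left C)
  rcases eq_or_ne k 0 with rfl | hk
  · simp [zero_rpow hρ.ne']
  have hk1 : (1 : ℝ) ≤ |(k : ℝ)| := by exact_mod_cast Int.one_le_abs hk
  have hk0 : (0 : ℝ) < |(k : ℝ)| := by linarith
  calc |(k : ℝ)| ^ ρ * ‖fourierCoeffOn (lt_add_of_pos_right (0 : ℝ) two_pi_pos) (fun t => w t) k‖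
      ≤ |(k : ℝ)| ^ (((⌈ρ⌉₊ + 2 : ℕ) : ℝ) + (-2)) * ‖fourierCoeffOn
        (lt_add_of_pos_right (0 : ℝ) two_pi_pos) (fun t => w t) k‖ := by
        gcongr
        · push_cast
          linarith [Nat.le_ceil ρ]
    _ = (|(k : ℝ)| ^ (⌈ρ⌉₊ + 2) * ‖fourierCoeffOn
        (lt_add_of_pos_right (0 : ℝ) two_pi_pos) (fun t => w t) k‖) * |(k : ℝ)| ^ (-2 : ℝ) := by
        rw [rpow_add hk0, rpow_natCast]
        ring
    _ ≤ C * |(k : ℝ)| ^ (-2 : ℝ) := by gcongr; exact hC k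

/-- The continuous function with Fourier coefficients `a`. -/
def fourierSeries (a : ℤ → ℂ) : C(Torus, ℂ) := ∑' k : ℤ, a k • fourier k

lemma hasSum_fourierSeries {a : ℤ → ℂ} (ha : Summable fun k => ‖a k‖) :
    HasSum (fun k => a k • (fourier k : C(Torus, ℂ))) (fourierSeries a) := by
  refine (Summable.of_norm ?_).hasSum
  simpa only [norm_smul, fourier_norm, mul_one] using ha

lemma hasSum_fourierSeries_apply {a : ℤ → ℂ} (ha : Summable fun k => ‖a k‖) (x : Torus) :
    HasSum (fun k => a k * fourier k x) (fourierSeries a x) :=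
  (ContinuousMap.evalCLM ℂ x).hasSum (hasSum_fourierSeries ha)

lemma fourierCoeff_fourierSeries {a : ℤ → ℂ} (ha : Summable fun k => ‖a k‖) (i : ℤ) :
    fourierCoeff (fourierSeries a) i = a i := by
  rw [← fourierCoeff_toLp, ← fourierBasis_repr, HilbertBasis.repr_apply_apply]
  have h := (innerSL ℂ (fourierBasis (T := 2 * π) i)).hasSum
    ((ContinuousMap.toLp (E := ℂ) 2 AddCircle.haarAddCircle ℂ).hasSum (hasSum_fourierSeries ha))
  refine h.unique ?_
  convert! hasSum_ite_eq i (a i) using 2 with k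
  have ho := orthonormal_iff_ite.1 (orthonormal_fourier (T := 2 * π)) i k
  simp only [map_smul, innerSL_apply_apply, coe_fourierBasis, smul_eq_mul]
  rw [ho]
  rcases eq_or_ne i k with rfl | hk
  · simp
  · simp [hk, hk.symm]

lemma lintegral_fourierSeries_sq {a : ℤ → ℂ} (ha : Summable fun k => ‖a k‖) :
    ∫⁻ x : Torus, ‖fourierSeries a x‖ₑ ^ 2 = ENNReal.ofReal (2 * π) * ∑' k, ‖a k‖ₑ ^ 2 := by
  have h := hasSum_sq_fourierCoeff
    (ContinuousMap.toLp (E := ℂ) 2 AddCircle.haarAddCircle ℂ (fourierSeries a))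
  simp_rw [fourierCoeff_toLp, fourierCoeff_fourierSeries ha] at h
  rw [integral_congr_ae (g := fun t => ‖fourierSeries a t‖ ^ 2)
    ((ContinuousMap.coeFn_toLp (𝕜 := ℂ) (p := 2) AddCircle.haarAddCircle
      (fourierSeries a)).mono fun t ht => by simp only [ht])] at h
  have hi : Integrable (fun t => ‖fourierSeries a t‖ ^ 2) (AddCircle.haarAddCircle (T := 2 * π)) :=
    ((map_continuous (fourierSeries a)).norm.pow 2).integrable_of_hasCompactSupport
      (HasCompactSupport.of_compactSpace _)
  rw [AddCircle.volume_eq_smul_haarAddCircle, lintegral_smul_measure, smul_eq_mul]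
  congr 1
  have e : ∀ z : ℂ, ‖z‖ₑ ^ 2 = ENNReal.ofReal (‖z‖ ^ 2) := fun z => by
    rw [ENNReal.ofReal_pow (norm_nonneg _), ofReal_norm]
  simp_rw [e]
  rw [← ofReal_integral_eq_lintegral_ofReal hi (Filter.Eventually.of_forall fun _ => by positivity),
    ← h.tsum_eq, ENNReal.ofReal_tsum_of_nonneg (fun _ => by positivity) h.summable]

/-- Either `g` is small, or some dyadic high-frequency part controls it. -/
lemma rpow_le_or_exists_dyadic {p s K M g : ℝ} (hp : 2 < p) (hs : 0 < s) (hK : 0 < K)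
    (hM : 0 < M) (hg : 0 ≤ g) {h : ℕ → ℝ}
    (hh : ∀ j : ℕ, g ≤ h j + K * ((2 : ℝ) ^ s) ^ j * M) :
    g ^ p ≤ (2 * K * M) ^ p ∨ ∃ j : ℕ, g ^ p ≤
      4 * (2 * K * M * 2 ^ s) ^ (p - 2) * (((2 : ℝ) ^ s) ^ (p - 2)) ^ j * h j ^ 2 := by
  set y : ℝ := 2 ^ s with hy
  have hy1 : 1 < y := one_lt_rpow (by norm_num) hs
  have hA : 0 < 2 * K * M := by positivity
  rcases le_total g (2 * K * M) with hle | hle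
  · exact Or.inl (rpow_le_rpow hg hle (by linarith))
  obtain ⟨j, hj1, hj2⟩ := exists_nat_pow_near ((one_le_div hA).2 hle) hy1
  refine Or.inr ⟨j, ?_⟩
  rw [le_div_iff₀ hA] at hj1
  rw [div_lt_iff₀ hA] at hj2
  have hg0 : 0 < g := hA.trans_le hle
  have h1 : g ≤ 2 * h j := by nlinarith [hh j]
  have h2 : g ^ 2 ≤ 4 * h j ^ 2 := by nlinarith
  have h3 : g ^ (p - 2) ≤ (2 * K * M * y) ^ (p - 2) * (y ^ (p - 2)) ^ j := by
    calc g ^ (p - 2) ≤ (2 * K * M * y * y ^ j) ^ (p - 2) := by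
          refine rpow_le_rpow hg ?_ (by linarith)
          rw [pow_succ] at hj2
          linarith
      _ = _ := by
          rw [mul_rpow (by positivity) (by positivity), ← rpow_natCast (y ^ (p - 2)),
            ← rpow_natCast y, ← rpow_mul (by positivity : 0 ≤ y),
            ← rpow_mul (by positivity : 0 ≤ y), mul_comm (j : ℝ)]
  calc g ^ p = g ^ (p - 2) * g ^ 2 := by
        rw [← rpow_natCast g 2, ← rpow_add hg0]
        norm_num
    _ ≤ (2 * K * M * y) ^ (p - 2) * (y ^ (p - 2)) ^ j * (4 * h j ^ 2) := by gcongr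
    _ = _ := by ring

lemma tsum_dyadic_le {α : ℝ} (hα : 0 < α) (n : ℕ) :
    ∑' j : ℕ, (if 2 ^ j < n then ENNReal.ofReal (((2 : ℝ) ^ α) ^ j) else 0)
      ≤ ENNReal.ofReal (2 ^ α / (2 ^ α - 1) * (n : ℝ) ^ α) := by
  have hr : (1 : ℝ) < 2 ^ α := one_lt_rpow (by norm_num) hα
  rcases eq_or_ne n 0 with rfl | hn
  · simp
  have hlog : ∀ j, j ∉ Finset.range (Nat.log 2 n + 1) →
      (if 2 ^ j < n then ENNReal.ofReal (((2 : ℝ) ^ α) ^ j) else 0) = 0 := fun j hj => by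
    refine if_neg fun hlt => hj (Finset.mem_range.2 (Nat.lt_succ_of_le ?_))
    exact Nat.le_log_of_pow_le (by norm_num) hlt.le
  rw [tsum_eq_sum hlog]
  calc _ ≤ ∑ j ∈ Finset.range (Nat.log 2 n + 1), ENNReal.ofReal (((2 : ℝ) ^ α) ^ j) := by
        refine Finset.sum_le_sum fun j _ => ?_
        split_ifs
        · exact le_rfl
        · exact zero_le
    _ = ENNReal.ofReal (∑ j ∈ Finset.range (Nat.log 2 n + 1), ((2 : ℝ) ^ α) ^ j) :=
        (ENNReal.ofReal_sum_of_nonneg fun _ _ => by positivity).symm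
    _ ≤ _ := by
        refine ENNReal.ofReal_le_ofReal ?_
        have h1 : ((2 : ℝ) ^ α) ^ Nat.log 2 n ≤ (n : ℝ) ^ α := by
          rw [← rpow_natCast, ← rpow_mul (by norm_num), mul_comm, rpow_mul (by norm_num),
            rpow_natCast]
          exact rpow_le_rpow (by positivity) (by exact_mod_cast Nat.pow_log_le_self 2 hn) hα.le
        rw [geom_sum_eq hr.ne', div_mul_eq_mul_div]
        refine div_le_div_of_nonneg_right ?_ (by linarith)
        rw [pow_succ]
        nlinarith

lemma fracD_eq_fourierSeries {w : Torus → ℂ} {ρ : ℝ}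
    (h : Summable fun k : ℤ => |(k : ℝ)| ^ ρ * ‖fourierCoeff w k‖) :
    fracD ρ w = fourierSeries fun k => ((|(k : ℝ)| ^ ρ : ℝ) : ℂ) * fourierCoeff w k := by
  funext x
  refine (hasSum_fourierSeries_apply ?_ x).tsum_eq
  refine h.congr fun k => ?_
  rw [norm_mul, Complex.norm_real, norm_of_nonneg (by positivity)]

/-- Fourier coefficients of the part of `|D|^s w` with frequencies above `N`. -/
def highCoeff (s : ℝ) (N : ℕ) (w : Torus → ℂ) (k : ℤ) : ℂ :=
  ((|(k : ℝ)| ^ s - lowSymbol s N k.natAbs : ℝ) : ℂ) * fourierCoeff w k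

lemma norm_highCoeff_le {s : ℝ} (hs : 0 < s) {N : ℕ} (hN : 1 ≤ N) (w : Torus → ℂ) (k : ℤ) :
    ‖highCoeff s N w k‖ ≤ if N < k.natAbs then |(k : ℝ)| ^ s * ‖fourierCoeff w k‖ else 0 := by
  have h := abs_rpow_sub_lowSymbol_le hs hN k.natAbs
  rw [Nat.cast_natAbs, Int.cast_abs] at h
  rw [highCoeff, norm_mul, Complex.norm_real, Real.norm_eq_abs]
  refine (mul_le_mul_of_nonneg_right h (norm_nonneg _)).trans_eq ?_
  split_ifs <;> simp

lemma summable_norm_highCoeff {w : Torus → ℂ} {s : ℝ} (hs : 0 < s)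
    (h : Summable fun k : ℤ => |(k : ℝ)| ^ s * ‖fourierCoeff w k‖) {N : ℕ} (hN : 1 ≤ N) :
    Summable fun k => ‖highCoeff s N w k‖ := by
  refine h.of_nonneg_of_le (fun _ => norm_nonneg _) fun k =>
    (norm_highCoeff_le hs hN w k).trans ?_
  split_ifs
  · exact le_rfl
  · positivity

lemma norm_fracD_le {w : Torus → ℂ} (hw : Continuous w) {M : ℝ} (hM : ∀ x, ‖w x‖ ≤ M)
    {s : ℝ} (hs : 0 < s) (h : Summable fun k : ℤ => |(k : ℝ)| ^ s * ‖fourierCoeff w k‖)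
    {N : ℕ} (hN : 1 ≤ N) (x : Torus) :
    ‖fracD s w x‖ ≤ ‖fourierSeries (highCoeff s N w) x‖ + lowConst s * (N : ℝ) ^ s * M := by
  have h1 := (hasSum_fourierSeries_apply (summable_norm_highCoeff hs h hN) x).add
    (hasSum_multiplier_lowSymbol w s N x).summable.hasSum
  have h2 : fracD s w x = fourierSeries (highCoeff s N w) x
      + multiplier (fun k => lowSymbol s N k.natAbs) w x := by
    refine Eq.trans (tsum_congr fun k => ?_) h1.tsum_eq
    simp only [highCoeff, Complex.ofReal_sub]
    ring
  rw [h2]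
  exact (norm_add_le _ _).trans
    (add_le_add_right (norm_multiplier_lowSymbol_le hw hM hs hN x) _)

lemma lintegral_high_sq_le {w : Torus → ℂ} {s : ℝ} (hs : 0 < s)
    (h : Summable fun k : ℤ => |(k : ℝ)| ^ s * ‖fourierCoeff w k‖) {N : ℕ} (hN : 1 ≤ N) :
    ∫⁻ x : Torus, ‖fourierSeries (highCoeff s N w) x‖ₑ ^ 2 ≤ ENNReal.ofReal (2 * π) *
      ∑' k : ℤ, if N < k.natAbs then
        ENNReal.ofReal ((|(k : ℝ)| ^ s * ‖fourierCoeff w k‖) ^ 2) else 0 := by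
  rw [lintegral_fourierSeries_sq (summable_norm_highCoeff hs h hN)]
  gcongr with k
  have := norm_highCoeff_le hs hN w k
  rw [← ofReal_norm, ← ENNReal.ofReal_pow (norm_nonneg _)]
  split_ifs at this ⊢ with hk
  · gcongr
  · simp [le_antisymm this (norm_nonneg _)]

lemma tsum_lintegral_high_sq_le {w : Torus → ℂ} {p s : ℝ} (hp : 2 < p) (hs : 0 < s)
    (h : Summable fun k : ℤ => |(k : ℝ)| ^ s * ‖fourierCoeff w k‖)
    (h' : Summable fun k : ℤ => |(k : ℝ)| ^ (s * p / 2) * ‖fourierCoeff w k‖) :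
    ∑' j : ℕ, ENNReal.ofReal (((2 : ℝ) ^ (s * (p - 2))) ^ j) *
        ∫⁻ x : Torus, ‖fourierSeries (highCoeff s (2 ^ j) w) x‖ₑ ^ 2
      ≤ ENNReal.ofReal (2 ^ (s * (p - 2)) / (2 ^ (s * (p - 2)) - 1)) *
        ∫⁻ x : Torus, ‖fracD (s * p / 2) w x‖ₑ ^ 2 := by
  have hα : 0 < s * (p - 2) := mul_pos hs (by linarith)
  set α := s * (p - 2) with hαdef
  have hr : (1 : ℝ) < 2 ^ α := one_lt_rpow (by norm_num) hα
  set B : ℝ := 2 ^ α / (2 ^ α - 1) with hB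
  have hB0 : 0 < B := div_pos (by linarith) (by linarith)
  have hsum : Summable fun k : ℤ =>
      ‖((|(k : ℝ)| ^ (s * p / 2) : ℝ) : ℂ) * fourierCoeff w k‖ :=
    h'.congr fun k => by rw [norm_mul, Complex.norm_real, norm_of_nonneg (by positivity)]
  rw [fracD_eq_fourierSeries h', lintegral_fourierSeries_sq hsum]
  calc _ ≤ ∑' j : ℕ, ENNReal.ofReal (((2 : ℝ) ^ α) ^ j) * (ENNReal.ofReal (2 * π) *
        ∑' k : ℤ, if 2 ^ j < k.natAbs then
          ENNReal.ofReal ((|(k : ℝ)| ^ s * ‖fourierCoeff w k‖) ^ 2) else 0) := by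
        gcongr with j
        exact lintegral_high_sq_le hs h Nat.one_le_two_pow
    _ = ENNReal.ofReal (2 * π) * ∑' k : ℤ, ENNReal.ofReal ((|(k : ℝ)| ^ s *
          ‖fourierCoeff w k‖) ^ 2) *
          ∑' j : ℕ, if 2 ^ j < k.natAbs then ENNReal.ofReal (((2 : ℝ) ^ α) ^ j) else 0 := by
        simp_rw [mul_left_comm _ (ENNReal.ofReal (2 * π))]
        rw [ENNReal.tsum_mul_left]
        simp_rw [← ENNReal.tsum_mul_left]
        rw [ENNReal.tsum_comm]
        refine tsum_congr fun k => tsum_congr fun j => congrArg _ ?_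
        split_ifs
        · rw [mul_comm]
        · simp
    _ ≤ ENNReal.ofReal (2 * π) * ∑' k : ℤ, ENNReal.ofReal ((|(k : ℝ)| ^ s *
          ‖fourierCoeff w k‖) ^ 2) * ENNReal.ofReal (B * |(k : ℝ)| ^ α) := by
        gcongr with k
        have := tsum_dyadic_le hα k.natAbs
        rwa [Nat.cast_natAbs, Int.cast_abs] at this
    _ = _ := by
        rw [mul_left_comm (ENNReal.ofReal B), ← ENNReal.tsum_mul_left (a := ENNReal.ofReal B)]
        refine congrArg _ (tsum_congr fun k => ?_)
        rw [← ofReal_norm, ← ENNReal.ofReal_pow (norm_nonneg _), ← ENNReal.ofReal_mul hB0.le,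
          ← ENNReal.ofReal_mul (by positivity), norm_mul, Complex.norm_real,
          norm_of_nonneg (by positivity)]
        congr 1
        rcases eq_or_ne k 0 with rfl | hk
        · simp [zero_rpow hs.ne', zero_rpow (by nlinarith : s * p / 2 ≠ 0)]
        have hk0 : (0 : ℝ) < |(k : ℝ)| := by simpa using hk
        have e : (|(k : ℝ)| ^ s) ^ 2 * |(k : ℝ)| ^ α = (|(k : ℝ)| ^ (s * p / 2)) ^ 2 := by
          rw [← rpow_natCast, ← rpow_natCast, ← rpow_mul hk0.le, ← rpow_mul hk0.le,
            ← rpow_add hk0, hαdef]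
          congr 1
          push_cast
          ring
        rw [mul_pow, mul_pow, ← e]
        ring

lemma lintegral_fracD_rpow_le {w : Torus → ℂ} (hw : Continuous w) {M : ℝ} (hM0 : 0 < M)
    (hM : ∀ x, ‖w x‖ ≤ M) {p s : ℝ} (hp : 2 < p) (hs : 0 < s)
    (h : Summable fun k : ℤ => |(k : ℝ)| ^ s * ‖fourierCoeff w k‖)
    (h' : Summable fun k : ℤ => |(k : ℝ)| ^ (s * p / 2) * ‖fourierCoeff w k‖) :
    ∫⁻ x : Torus, ‖fracD s w x‖ₑ ^ p ≤ ENNReal.ofReal ((2 * lowConst s * M) ^ p * (2 * π)) +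
      ENNReal.ofReal (4 * (2 * lowConst s * M * 2 ^ s) ^ (p - 2) *
        (2 ^ (s * (p - 2)) / (2 ^ (s * (p - 2)) - 1))) *
        ∫⁻ x : Torus, ‖fracD (s * p / 2) w x‖ₑ ^ 2 := by
  have hK := lowConst_pos s
  set A : ℝ := 4 * (2 * lowConst s * M * 2 ^ s) ^ (p - 2) with hA
  have hA0 : 0 ≤ A := by positivity
  have hpt : ∀ x : Torus, ‖fracD s w x‖ₑ ^ p ≤ ENNReal.ofReal ((2 * lowConst s * M) ^ p) +
      ∑' j : ℕ, ENNReal.ofReal (A * (((2 : ℝ) ^ (s * (p - 2))) ^ j)) *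
        ‖fourierSeries (highCoeff s (2 ^ j) w) x‖ₑ ^ 2 := by
    intro x
    rw [← ofReal_norm, ENNReal.ofReal_rpow_of_nonneg (norm_nonneg _) (by linarith)]
    have hh : ∀ j : ℕ, ‖fracD s w x‖ ≤ ‖fourierSeries (highCoeff s (2 ^ j) w) x‖
        + lowConst s * ((2 : ℝ) ^ s) ^ j * M := fun j => by
      have := norm_fracD_le hw hM hs h (Nat.one_le_two_pow (n := j)) x
      rwa [Nat.cast_pow, Nat.cast_ofNat, ← rpow_natCast, ← rpow_mul (by norm_num),
        mul_comm (j : ℝ), rpow_mul (by norm_num), rpow_natCast] at this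
    rcases rpow_le_or_exists_dyadic hp hs hK hM0 (norm_nonneg _) hh with h1 | ⟨j, hj⟩
    · exact le_add_right (ENNReal.ofReal_le_ofReal h1)
    · refine le_add_left (le_trans ?_ (ENNReal.le_tsum j))
      rw [← ofReal_norm, ← ENNReal.ofReal_pow (norm_nonneg _),
        ← ENNReal.ofReal_mul (by positivity), rpow_mul (by norm_num)]
      exact ENNReal.ofReal_le_ofReal hj
  refine (lintegral_mono hpt).trans ?_
  have hmeas : ∀ j : ℕ, Measurable fun x : Torus =>
      ‖fourierSeries (highCoeff s (2 ^ j) w) x‖ₑ ^ 2 := fun j =>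
    ((map_continuous _).measurable.enorm).pow_const 2
  rw [lintegral_add_left measurable_const, lintegral_const,
    lintegral_tsum fun j => ((hmeas j).const_mul _).aemeasurable, AddCircle.measure_univ,
    ← ENNReal.ofReal_mul (by positivity)]
  simp_rw [lintegral_const_mul _ (hmeas _), ENNReal.ofReal_mul hA0, mul_assoc]
  rw [ENNReal.tsum_mul_left]
  gcongr
  exact tsum_lintegral_high_sq_le hp hs h h'

/-- Gagliardo–Nirenberg-type inequality:
`‖|D|^s f‖_{L^p} ≤ C (‖f‖_{L^∞} + ‖|D|^{sp/2} f‖_{L²}^{2/p} ‖f‖_{L^∞}^{1-2/p})`. -/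
theorem gagliardo_nirenberg_fracD (p s : ℝ) (hp : 2 < p) (hs : 0 < s) :
    ∃ C > 0, ∀ f : Torus → ℝ, ContDiff ℝ (⊤ : ℕ∞) (fun t : ℝ => f t) →
      eLpNorm (fracD s fun x => (f x : ℂ)) (ENNReal.ofReal p) volume ≤
        ENNReal.ofReal
          (C * ((⨆ x : Torus, |f x|) +
            ((eLpNorm (fracD (s * p / 2) fun x => (f x : ℂ)) 2 volume).toReal) ^ (2 / p) *
              (⨆ x : Torus, |f x|) ^ (1 - 2 / p))) := by
  have hp0 : 0 < p := by linarith
  have hK := lowConst_pos s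
  set K := lowConst s
  have hr : (1 : ℝ) < 2 ^ (s * (p - 2)) :=
    one_lt_rpow (by norm_num) (mul_pos hs (by linarith))
  set B : ℝ := 2 ^ (s * (p - 2)) / (2 ^ (s * (p - 2)) - 1) with hB
  have hB0 : 0 < B := div_pos (by linarith) (by linarith)
  set C₁ : ℝ := 2 * K * (2 * π) ^ (1 / p) with hC₁
  set C₂ : ℝ := (4 * (2 * K * 2 ^ s) ^ (p - 2) * B) ^ (1 / p) with hC₂
  have hC₁0 : 0 < C₁ := by positivity
  have hC₂0 : 0 < C₂ := by positivity
  refine ⟨C₁ + C₂, by positivity, fun f hf => ?_⟩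
  have hfc : Continuous f := by
    rw [(QuotientAddGroup.isQuotientMap_mk (N := AddSubgroup.zmultiples (2 * π))).continuous_iff]
    exact hf.continuous
  set w : Torus → ℂ := fun x => (f x : ℂ) with hw
  have hwc : Continuous w := Complex.continuous_ofReal.comp hfc
  have hws : ContDiff ℝ (⊤ : ℕ∞) (fun t : ℝ => w t) := Complex.ofRealCLM.contDiff.comp hf
  set M := ⨆ x : Torus, |f x| with hMdef
  have hfM : ∀ x, |f x| ≤ M := le_ciSup (isCompact_range hfc.abs).bddAbove
  have hM : ∀ x, ‖w x‖ ≤ M := fun x => by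
    rw [hw, Complex.norm_real]
    exact hfM x
  have hM0 : 0 ≤ M := (abs_nonneg _).trans (hfM 0)
  have hsum := summable_rpow_mul_fourierCoeff hws hs
  have hsum' := summable_rpow_mul_fourierCoeff hws (by positivity : 0 < s * p / 2)
  rcases hM0.eq_or_lt with hz | hpos
  · have hw0 : w = 0 := funext fun x => norm_le_zero_iff.1 ((hM x).trans_eq hz.symm)
    have hg : fracD s w = 0 := by
      funext x
      simp [fracD, hw0, fourierCoeff]
    rw [hg, eLpNorm_zero]
    exact zero_le
  set E := (eLpNorm (fracD (s * p / 2) w) 2 volume).toReal with hE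
  have hE2 : ∫⁻ x : Torus, ‖fracD (s * p / 2) w x‖ₑ ^ 2 = ENNReal.ofReal (E ^ 2) := by
    have hfin : eLpNorm (fracD (s * p / 2) w) 2 volume ≠ ⊤ := by
      rw [fracD_eq_fourierSeries hsum']
      exact ((map_continuous (fourierSeries _)).memLp_of_hasCompactSupport
        (HasCompactSupport.of_compactSpace _)).eLpNorm_ne_top
    rw [hE, ENNReal.ofReal_pow ENNReal.toReal_nonneg, ENNReal.ofReal_toReal hfin,
      eLpNorm_eq_lintegral_rpow_enorm_toReal (by norm_num) (by norm_num), ← ENNReal.rpow_natCast,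
      ← ENNReal.rpow_mul]
    norm_num
  have hE0 : 0 ≤ E := ENNReal.toReal_nonneg
  have hmain := lintegral_fracD_rpow_le hwc hpos hM hp hs hsum hsum'
  rw [hE2, ← ENNReal.ofReal_mul (by positivity)] at hmain
  rw [eLpNorm_eq_lintegral_rpow_enorm_toReal (by simpa using hp0) ENNReal.ofReal_ne_top,
    ENNReal.toReal_ofReal hp0.le]
  have hp1 : 1 / p ≤ 1 := by rw [div_le_one hp0]; linarith
  refine (ENNReal.rpow_le_rpow hmain (by positivity)).trans
    ((ENNReal.rpow_add_le_add_rpow _ _ (by positivity) hp1).trans ?_)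
  rw [ENNReal.ofReal_rpow_of_nonneg (by positivity) (by positivity),
    ENNReal.ofReal_rpow_of_nonneg (by positivity) (by positivity),
    ← ENNReal.ofReal_add (by positivity) (by positivity)]
  refine ENNReal.ofReal_le_ofReal ?_
  have e1 : ((2 * K * M) ^ p * (2 * π)) ^ (1 / p) = C₁ * M := by
    rw [mul_rpow (by positivity) (by positivity), ← rpow_mul (by positivity),
      mul_one_div_cancel hp0.ne', rpow_one]
    ring
  have e2 : (4 * (2 * K * M * 2 ^ s) ^ (p - 2) * B * E ^ 2) ^ (1 / p)
      = C₂ * (E ^ (2 / p) * M ^ (1 - 2 / p)) := by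
    have : 4 * (2 * K * M * 2 ^ s) ^ (p - 2) * B * E ^ 2
        = 4 * (2 * K * 2 ^ s) ^ (p - 2) * B * (E ^ (2 : ℝ) * M ^ (p - 2)) := by
      rw [show 2 * K * M * 2 ^ s = 2 * K * 2 ^ s * M by ring,
        mul_rpow (by positivity) (by positivity), rpow_two]
      ring
    rw [this, mul_rpow (by positivity) (by positivity),
      mul_rpow (x := E ^ (2 : ℝ)) (by positivity) (by positivity),
      ← rpow_mul hE0, ← rpow_mul hM0, hC₂]
    congr 3
    · ring
    · field_simp
  rw [e1, e2]
  have h1 : 0 ≤ E ^ (2 / p) * M ^ (1 - 2 / p) := by positivity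
  nlinarith [mul_nonneg hC₂0.le hM0, mul_nonneg hC₁0.le h1]

end
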